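/- arXiv:2202.03024 — 2 statements merged into one kernel-verified Lean document; each statement's English description precedes it below -/
import Mathlib

section
/- For every integer n ≥ 2 and every integer q ≥ 2, the maximum of the input entropy H^In_{1-Del}(y) over all channel outputs y ∈ Σ_q^{n−1} equals log₂(nq) − 2(n−1)/(nq), and it is attained exactly by the words y ∈ Σ_q^{n−1} with ρ(y) = n−1 runs (i.e., all runs of length one). -/
open scoped Classical

noncomputable section

/-- The embedding number `ω_y(x)`: the number of distinct occurrences of `y`
as a subsequence of `x` (i.e. the number of index tuples realizing `y` in `x`). -/
def emb {q : ℕ} (y x : List (Fin q)) : ℕ := x.sublists.count y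

/-- The run length profile of a word: the list of lengths of its maximal
blocks of identical consecutive symbols, in order. -/
def runLengths {α : Type*} [DecidableEq α] : List α → List ℕ
  | [] => []
  | [_] => [1]
  | a :: b :: l =>
    if a = b then
      match runLengths (b :: l) with
      | [] => [1]
      | r :: rs => (r + 1) :: rs
    else 1 :: runLengths (b :: l)

/-- Input entropy `H^In_{k-Del}(y)` of the `k`-deletion channel over `Σ_q`
under uniform transmission, for a channel output `y ∈ Σ_q^{n-k}`:
`-∑_{x ∈ I_k(y)} p(x) log₂ p(x)` with `p(x) = ω_y(x) / (C(n,k) q^k)`. -/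
def Hdel (q n k : ℕ) (y : Fin (n - k) → Fin q) : ℝ :=
  - ∑ x ∈ Finset.univ.filter
      (fun x : Fin n → Fin q => (List.ofFn y).Sublist (List.ofFn x)),
      ((emb (List.ofFn y) (List.ofFn x) : ℝ) / ((n.choose k : ℝ) * (q : ℝ) ^ k)) *
        Real.logb 2 ((emb (List.ofFn y) (List.ofFn x) : ℝ) / ((n.choose k : ℝ) * (q : ℝ) ^ k))

/-- Input entropy `H^In_{k-Ins}(y)` of the `k`-insertion channel over `Σ_q`
under uniform transmission, for a channel output `y ∈ Σ_q^{n+k}`: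
`-∑_{x ∈ D_k(y)} p(x) log₂ p(x)` with `p(x) = ω_x(y) / C(n+k,k)`. -/
def Hins (q n k : ℕ) (y : Fin (n + k) → Fin q) : ℝ :=
  - ∑ x ∈ Finset.univ.filter
      (fun x : Fin n → Fin q => (List.ofFn x).Sublist (List.ofFn y)),
      ((emb (List.ofFn x) (List.ofFn y) : ℝ) / ((n + k).choose k : ℝ)) *
        Real.logb 2 ((emb (List.ofFn x) (List.ofFn y) : ℝ) / ((n + k).choose k : ℝ))

/-- A run length profile `rl` of a word of length `m` with `R` runs is balanced if it
consists of `m mod R` runs of length `⌈m/R⌉` and `R - (m mod R)` runs of length `⌊m/R⌋`. -/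
def isBalanced (m R : ℕ) (rl : List ℕ) : Prop :=
  rl.Perm (List.replicate (m % R) ((m + R - 1) / R) ++ List.replicate (R - m % R) (m / R))

/-- A run length profile `rl` of a word of length `m` with `R` runs is skewed if it
consists of `R - 1` runs of length `1` and a single run of length `m - (R-1)`. -/
def isSkewed (m R : ℕ) (rl : List ℕ) : Prop :=
  rl.Perm ((m - (R - 1)) :: List.replicate (R - 1) 1)

/-- `fIdx rl i` is the smallest (1-based) index `j ∈ [i+1, R]` with `r_j > 1`;
it is `R` if no such index exists, and `fIdx rl R = R`. -/
def fIdx (rl : List ℕ) (i : ℕ) : ℕ :=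
  if i = rl.length then rl.length
  else if {j | i + 1 ≤ j ∧ j ≤ rl.length ∧ 1 < rl.getD (j - 1) 0}.Nonempty
    then sInf {j | i + 1 ≤ j ∧ j ≤ rl.length ∧ 1 < rl.getD (j - 1) 0}
    else rl.length

/-- `bIdx rl i` is the largest (1-based) index `j ∈ [1, i]` with `r_j > 1`;
it is `1` if no such index exists, and `bIdx rl 0 = 1`. -/
def bIdx (rl : List ℕ) (i : ℕ) : ℕ :=
  if i = 0 then 1
  else if {j | 1 ≤ j ∧ j ≤ i ∧ 1 < rl.getD (j - 1) 0}.Nonempty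
    then sSup {j | 1 ≤ j ∧ j ≤ i ∧ 1 < rl.getD (j - 1) 0}
    else 1

section RunLengths

variable {α : Type*} [DecidableEq α]

lemma runLengths_ne_nil (a : α) (l : List α) : runLengths (a :: l) ≠ [] := by
  cases l with
  | nil => simp [runLengths]
  | cons b l =>
    rw [runLengths]
    split_ifs
    · split <;> simp
    · simp

lemma length_runLengths_cons_cons_self (a : α) (l : List α) :
    (runLengths (a :: a :: l)).length = (runLengths (a :: l)).length := by
  rw [runLengths, if_pos rfl]
  split
  · next h => exact absurd h (runLengths_ne_nil a l)
  · next h => simp [h]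

lemma length_runLengths_cons_cons_of_ne {a b : α} (h : a ≠ b) (l : List α) :
    (runLengths (a :: b :: l)).length = (runLengths (b :: l)).length + 1 := by
  rw [runLengths, if_neg h, List.length_cons]

lemma length_runLengths_le : ∀ l : List α, (runLengths l).length ≤ l.length
  | [] => by simp [runLengths]
  | [_] => by simp [runLengths]
  | a :: b :: l => by
    have ih := length_runLengths_le (b :: l)
    by_cases h : a = b
    · subst h
      rw [length_runLengths_cons_cons_self, List.length_cons]
      omega
    · rw [length_runLengths_cons_cons_of_ne h, List.length_cons]
      omega

lemma exists_length_runLengths_eq [Nontrivial α] (n : ℕ) :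
    ∃ l : List α, l.length = n ∧ (runLengths l).length = n := by
  induction n with
  | zero => exact ⟨[], by simp [runLengths]⟩
  | succ n ih =>
    obtain ⟨l, hl, hr⟩ := ih
    cases l with
    | nil =>
      obtain ⟨a, -⟩ := exists_pair_ne α
      subst hl
      exact ⟨[a], by simp [runLengths]⟩
    | cons b l =>
      obtain ⟨a, ha⟩ := exists_ne b
      exact ⟨a :: b :: l, by simpa using hl, by rw [length_runLengths_cons_cons_of_ne ha, hr]⟩

end RunLengths

section Embedding

variable {q : ℕ}

lemma emb_eq_count_sublists' (y x : List (Fin q)) : emb y x = x.sublists'.count y :=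
  (List.sublists_perm_sublists' x).count_eq y

lemma emb_nil_left (x : List (Fin q)) : emb [] x = 1 := by
  rw [emb_eq_count_sublists']
  induction x with
  | nil => simp
  | cons a x ih =>
    rw [List.sublists'_cons, List.count_append, ih, List.count_eq_zero_of_not_mem (by simp)]

lemma emb_eq_zero_of_not_sublist {y x : List (Fin q)} (h : ¬ y.Sublist x) : emb y x = 0 :=
  List.count_eq_zero_of_not_mem (by rwa [List.mem_sublists])

lemma emb_cons_cons (b a : Fin q) (y x : List (Fin q)) :
    emb (b :: y) (a :: x) = emb (b :: y) x + if a = b then emb y x else 0 := by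
  simp only [emb_eq_count_sublists', List.sublists'_cons, List.count_append]
  congr 1
  split_ifs with h
  · subst h
    exact List.count_map_of_injective _ _ List.cons_injective _
  · exact List.count_eq_zero_of_not_mem (by simp [h])

lemma emb_of_length_eq {y x : List (Fin q)} (h : x.length = y.length) :
    emb y x = if x = y then 1 else 0 := by
  split_ifs with hxy
  · subst hxy
    clear h
    induction x with
    | nil => exact emb_nil_left []
    | cons a x ih =>
      rw [emb_cons_cons, if_pos rfl, ih, emb_eq_zero_of_not_sublist]
      intro hs
      simpa using hs.length_le
  · exact emb_eq_zero_of_not_sublist fun hs => hxy (hs.eq_of_length h.symm).symm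

lemma emb_cons_cons_of_length {b a : Fin q} {y x : List (Fin q)} (h : x.length = y.length + 1) :
    emb (b :: y) (a :: x) = (if x = b :: y then 1 else 0) + if a = b then emb y x else 0 := by
  rw [emb_cons_cons, emb_of_length_eq (by simpa using h)]

/-- The sum of `g` over all words of length `n`. -/
def wordSum (q n : ℕ) (g : List (Fin q) → ℝ) : ℝ := ∑ x : Fin n → Fin q, g (List.ofFn x)

lemma wordSum_succ (n : ℕ) (g : List (Fin q) → ℝ) :
    wordSum q (n + 1) g = ∑ a, wordSum q n fun l => g (a :: l) := by
  unfold wordSum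
  rw [← Fintype.sum_prod_type' fun (a : Fin q) (x : Fin n → Fin q) => g (a :: List.ofFn x)]
  refine (Fintype.sum_equiv (Fin.consEquiv fun _ => Fin q) _ _ fun p => ?_).symm
  simp [Fin.consEquiv]

lemma wordSum_congr {n : ℕ} {g h : List (Fin q) → ℝ} (H : ∀ l, l.length = n → g l = h l) :
    wordSum q n g = wordSum q n h :=
  Finset.sum_congr rfl fun _ _ => H _ (List.length_ofFn)

lemma wordSum_add (n : ℕ) (g h : List (Fin q) → ℝ) :
    (wordSum q n fun l => g l + h l) = wordSum q n g + wordSum q n h :=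
  Finset.sum_add_distrib

lemma wordSum_single (n : ℕ) {w : List (Fin q)} (hw : w.length = n) (c : ℝ) :
    (wordSum q n fun l => if l = w then c else 0) = c := by
  subst hw
  unfold wordSum
  rw [Finset.sum_eq_single w.get]
  · simp
  · intro x _ hx
    refine if_neg fun h => hx ?_
    apply List.ofFn_injective
    rw [h, List.ofFn_get]
  · simp

lemma wordSum_emb (y : List (Fin q)) :
    (wordSum q (y.length + 1) fun x => (emb y x : ℝ)) = (y.length + 1) * q := by
  induction y with
  | nil => simp [wordSum, emb_nil_left]
  | cons b y ih =>
    rw [wordSum_succ]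
    have h (a : Fin q) : (wordSum q (b :: y).length fun l => (emb (b :: y) (a :: l) : ℝ)) =
        1 + if a = b then ((y.length : ℝ) + 1) * q else 0 := by
      rw [wordSum_congr (h := fun l => (if l = b :: y then (1 : ℝ) else 0) +
          if a = b then (emb y l : ℝ) else 0), wordSum_add, wordSum_single _ rfl]
      · split_ifs
        · rw [← ih, List.length_cons]
        · simp [wordSum]
      · intro l hl
        rw [emb_cons_cons_of_length (by simpa using hl)]
        push_cast
        rfl
    simp only [h, Finset.sum_add_distrib]
    simp
    ring

/-- `x log₂ x`. -/
def mulLogb (x : ℝ) : ℝ := x * Real.logb 2 x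

lemma mulLogb_zero : mulLogb 0 = 0 := by simp [mulLogb]

lemma mulLogb_one : mulLogb 1 = 0 := by simp [mulLogb]

lemma two_mul_le_mulLogb (k : ℕ) :
    2 * ((k : ℝ) + 1) ≤ mulLogb (k + 2) ∧ (mulLogb (k + 2) = 2 * ((k : ℝ) + 1) ↔ k = 0) := by
  rcases Nat.eq_zero_or_pos k with rfl | hk
  · simp [mulLogb]
  suffices h : 2 * ((k : ℝ) + 1) < mulLogb (k + 2) from
    ⟨h.le, by simp only [h.ne', hk.ne']⟩
  unfold mulLogb
  rcases Nat.lt_or_ge k 2 with h2 | h2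
  · obtain rfl : k = 1 := by omega
    have h : (4 : ℝ) < Real.logb 2 ((3 : ℝ) ^ (3 : ℕ)) := by
      rw [Real.lt_logb_iff_rpow_lt (by norm_num) (by norm_num)]
      norm_num
    rw [Real.logb_pow] at h
    norm_num at h ⊢
    exact h
  · have h2' : (2 : ℝ) ≤ k := by exact_mod_cast h2
    have h : (2 : ℝ) ≤ Real.logb 2 (k + 2) := by
      rw [Real.le_logb_iff_rpow_le (by norm_num) (by positivity)]
      norm_num
      linarith
    nlinarith

/-- The sum of `ω log₂ ω` over the words `x` of length one more than `b :: y`, where the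
embedding number `ω` of `b :: y` in `x` is increased by `k` at the word `b :: b :: y`. -/
def shiftedSum (k : ℕ) (b : Fin q) (y : List (Fin q)) : ℝ :=
  wordSum q (y.length + 2) fun x =>
    mulLogb ((emb (b :: y) x : ℝ) + if x = b :: b :: y then (k : ℝ) else 0)

lemma shiftedSum_eq (k : ℕ) (b : Fin q) (y : List (Fin q)) :
    shiftedSum k b y = wordSum q (y.length + 1) fun x =>
      mulLogb ((emb y x : ℝ) + if x = b :: y then (k : ℝ) + 1 else 0) := by
  rw [shiftedSum, wordSum_succ, Finset.sum_eq_single b]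
  · refine wordSum_congr fun l hl => ?_
    rw [emb_cons_cons_of_length hl]
    by_cases h : l = b :: y
    · simp [h]
      ring_nf
    · simp [h]
  · intro a _ hab
    refine Finset.sum_eq_zero fun x _ => ?_
    beta_reduce
    rw [emb_cons_cons_of_length (by simp)]
    generalize List.ofFn x = l
    by_cases h : l = b :: y <;> simp [h, hab, mulLogb_zero, mulLogb_one]
  · simp

lemma shiftedSum_cons_self (k : ℕ) (b : Fin q) (y : List (Fin q)) :
    shiftedSum k b (b :: y) = shiftedSum (k + 1) b y := by
  rw [shiftedSum_eq, shiftedSum]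
  simp

lemma wordSum_mulLogb_add {y w : List (Fin q)} (hw : w.length = y.length + 1)
    (h : emb y w = 1) (k : ℕ) :
    (wordSum q (y.length + 1) fun x =>
      mulLogb ((emb y x : ℝ) + if x = w then (k : ℝ) + 1 else 0)) =
      (wordSum q (y.length + 1) fun x => mulLogb (emb y x)) + mulLogb (k + 2) := by
  conv_rhs => rw [← wordSum_single _ hw (mulLogb (k + 2)), ← wordSum_add]
  refine wordSum_congr fun l _ => ?_
  by_cases hl : l = w
  · subst hl
    simp only [h, if_true, Nat.cast_one, mulLogb_one]
    ring_nf
  · simp [hl]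

lemma shiftedSum_nil (k : ℕ) (b : Fin q) : shiftedSum k b [] = mulLogb (k + 2) := by
  rw [shiftedSum_eq, wordSum_mulLogb_add (by simp) (emb_nil_left _)]
  simp [wordSum, emb_nil_left, mulLogb_one]

lemma shiftedSum_cons_of_ne (k : ℕ) {b c : Fin q} (h : b ≠ c) (y : List (Fin q)) :
    shiftedSum k b (c :: y) = shiftedSum 0 c y + mulLogb (k + 2) := by
  rw [shiftedSum_eq, wordSum_mulLogb_add (by simp), shiftedSum]
  · simp
  · rw [emb_cons_cons_of_length (by simp)]
    simp [h]

lemma two_mul_le_shiftedSum (k : ℕ) (b : Fin q) (y : List (Fin q)) :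
    2 * ((y.length : ℝ) + 1 + k) ≤ shiftedSum k b y ∧
      (shiftedSum k b y = 2 * ((y.length : ℝ) + 1 + k) ↔
        k = 0 ∧ (runLengths (b :: y)).length = y.length + 1) := by
  induction y generalizing k b with
  | nil =>
    obtain ⟨h₁, h₂⟩ := two_mul_le_mulLogb k
    rw [shiftedSum_nil]
    simp only [List.length_nil, Nat.cast_zero, zero_add, runLengths, List.length_cons, and_true]
    rw [add_comm (1 : ℝ)]
    exact ⟨h₁, h₂⟩
  | cons c y ih =>
    by_cases h : b = c
    · subst h
      obtain ⟨h₁, h₂⟩ := ih (k + 1) b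
      rw [shiftedSum_cons_self, length_runLengths_cons_cons_self]
      have hle := length_runLengths_le (b :: y)
      have e : 2 * (((b :: y).length : ℝ) + 1 + k) = 2 * ((y.length : ℝ) + 1 + (k + 1 : ℕ)) := by
        push_cast [List.length_cons]
        ring
      rw [e, h₂]
      refine ⟨h₁, ?_⟩
      simp only [List.length_cons] at hle ⊢
      omega
    · obtain ⟨h₁, h₂⟩ := ih 0 c
      obtain ⟨h₃, h₄⟩ := two_mul_le_mulLogb k
      rw [shiftedSum_cons_of_ne k h, length_runLengths_cons_cons_of_ne h]
      simp only [Nat.cast_zero, add_zero, true_and] at h₁ h₂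
      simp only [List.length_cons, Nat.cast_add, Nat.cast_one, add_left_inj]
      rw [← h₂, ← h₄]
      refine ⟨by linarith, fun H => ⟨by linarith, by linarith⟩, fun ⟨H₁, H₂⟩ => by linarith⟩

lemma wordSum_mulLogb_emb_cons (b : Fin q) (y : List (Fin q)) :
    (wordSum q ((b :: y).length + 1) fun x => mulLogb (emb (b :: y) x)) = shiftedSum 0 b y := by
  simp [shiftedSum]

end Embedding

lemma Hdel_one_eq {q m : ℕ} (hq : 0 < q) (y : Fin m → Fin q) :
    Hdel q (m + 1) 1 y = Real.logb 2 ((m + 1 : ℕ) * q : ℝ) -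
      (wordSum q ((List.ofFn y).length + 1) fun x => mulLogb (emb (List.ofFn y) x)) /
        ((m + 1 : ℕ) * q) := by
  have hN : ((m + 1 : ℕ) * q : ℝ) ≠ 0 := by positivity
  have hs := wordSum_emb (List.ofFn y)
  rw [List.length_ofFn] at hs ⊢
  unfold Hdel
  simp only [Nat.choose_one_right, pow_one]
  set N : ℝ := (m + 1 : ℕ) * q with hNdef
  rw [Finset.sum_filter_of_ne (p := fun x : Fin (m + 1) → Fin q =>
    (List.ofFn y).Sublist (List.ofFn x))]
  · have key (x : Fin (m + 1) → Fin q) :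
        (emb (List.ofFn y) (List.ofFn x) / N : ℝ) *
            Real.logb 2 (emb (List.ofFn y) (List.ofFn x) / N) =
          mulLogb (emb (List.ofFn y) (List.ofFn x)) / N -
            emb (List.ofFn y) (List.ofFn x) * (Real.logb 2 N / N) := by
      by_cases h : (emb (List.ofFn y) (List.ofFn x) : ℝ) = 0
      · simp only [h, mulLogb_zero, zero_div, zero_mul, sub_zero]
      · rw [Real.logb_div h hN, mulLogb]
        ring
    have hs' : ∑ x : Fin (m + 1) → Fin q, (emb (List.ofFn y) (List.ofFn x) : ℝ) = N := by
      rw [hNdef]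
      push_cast
      exact hs
    simp only [key, Finset.sum_sub_distrib, ← Finset.sum_div, ← Finset.sum_mul, hs']
    rw [mul_div_cancel₀ _ hN, wordSum]
    ring
  · intro x _ hx
    contrapose! hx
    simp only [emb_eq_zero_of_not_sublist hx, Nat.cast_zero, zero_div, zero_mul]

lemma Hdel_one_le {q m : ℕ} (hm : 0 < m) (y : Fin m → Fin q) :
    Hdel q (m + 1) 1 y ≤ Real.logb 2 ((m + 1 : ℕ) * q : ℝ) - 2 * (m : ℝ) / ((m + 1 : ℕ) * q) ∧
      (Hdel q (m + 1) 1 y =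
          Real.logb 2 ((m + 1 : ℕ) * q : ℝ) - 2 * (m : ℝ) / ((m + 1 : ℕ) * q) ↔
        (runLengths (List.ofFn y)).length = m) := by
  have hq : 0 < q := (y ⟨0, hm⟩).pos
  have hN : (0 : ℝ) < (m + 1 : ℕ) * q := by positivity
  rw [Hdel_one_eq hq]
  have hl : (List.ofFn y).length = m := List.length_ofFn
  generalize List.ofFn y = l at hl
  cases l with
  | nil => simp at hl; omega
  | cons b l =>
    obtain ⟨h₁, h₂⟩ := two_mul_le_shiftedSum 0 b l
    rw [wordSum_mulLogb_emb_cons]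
    subst hl
    simp only [Nat.cast_zero, add_zero, true_and] at h₁ h₂
    rw [sub_right_inj, div_left_inj' hN.ne', List.length_cons, Nat.cast_add_one l.length, h₂]
    refine ⟨?_, Iff.rfl⟩
    gcongr

/-- For `n ≥ 2` and `q ≥ 2`, the maximum input entropy of the `1`-deletion channel over
all channel outputs in `Σ_q^{n-1}` equals `log₂(nq) - 2(n-1)/(nq)`, and it is attained
exactly by the channel outputs with `n-1` runs. -/
theorem stmt_7 (q n : ℕ) (hq : 2 ≤ q) (hn : 2 ≤ n) :
    IsGreatest ((fun y : Fin (n - 1) → Fin q => Hdel q n 1 y) '' Set.univ)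
      (Real.logb 2 ((n : ℝ) * q) - 2 * ((n - 1 : ℕ) : ℝ) / ((n : ℝ) * q))
    ∧ ∀ y : Fin (n - 1) → Fin q,
        (Hdel q n 1 y =
            Real.logb 2 ((n : ℝ) * q) - 2 * ((n - 1 : ℕ) : ℝ) / ((n : ℝ) * q)
          ↔ (runLengths (List.ofFn y)).length = n - 1) := by
  obtain ⟨m, rfl⟩ : ∃ m, n = m + 1 := ⟨n - 1, by omega⟩
  have hm : 0 < m := by omega
  refine ⟨⟨?_, ?_⟩, fun y => (Hdel_one_le hm y).2⟩
  · have : Nontrivial (Fin q) := Fin.nontrivial_iff_two_le.mpr hq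
    obtain ⟨l, hl, hr⟩ := exists_length_runLengths_eq (α := Fin q) m
    subst hl
    refine ⟨l.get, Set.mem_univ _, (Hdel_one_le hm l.get).2.mpr ?_⟩
    rw [List.ofFn_get, hr]
  · rintro _ ⟨y, -, rfl⟩
    exact (Hdel_one_le hm y).1

end
end

section
/- Let n ≥ 1, q ≥ 2, m = n+1, R ∈ {1,…,m}, and r = m mod R. The maximum of H^In_{1-Ins}(y) over all y ∈ Σ_{q,R}^m equals log₂(m) − (1/m)·(r·⌈m/R⌉ log₂⌈m/R⌉ + (R−r)·⌊m/R⌋ log₂⌊m/R⌋), and this maximum is attained exactly by the balanced words of Σ_{q,R}^m. -/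
open scoped Classical

noncomputable section

section Runs

variable {α : Type*}

/-- The words obtained by deleting one symbol, one for each position of the deleted symbol. -/
def singleDeletions : List α → List (List α)
  | [] => []
  | a :: l => l :: (singleDeletions l).map (List.cons a)

lemma length_of_mem_singleDeletions {l z : List α} (h : z ∈ singleDeletions l) :
    z.length + 1 = l.length := by
  induction l generalizing z with
  | nil => simp [singleDeletions] at h
  | cons a l ih =>
    simp only [singleDeletions, List.mem_cons, List.mem_map] at h
    rcases h with rfl | ⟨w, hw, rfl⟩
    · simp
    · simp [ih hw]

variable [DecidableEq α]

lemma count_map_cons (a c : α) (x : List α) (L : List (List α)) :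
    (L.map (List.cons a)).count (c :: x) = if c = a then L.count x else 0 := by
  split_ifs with h
  · subst h
    exact List.count_map_of_injective _ _ (List.cons_injective) _
  · refine List.count_eq_zero_of_not_mem fun hm => ?_
    simp only [List.mem_map, List.cons.injEq] at hm
    obtain ⟨_, _, h', _⟩ := hm
    exact h h'.symm

lemma count_sublists'_of_length_eq {x l : List α} (h : x.length = l.length) :
    l.sublists'.count x = if x = l then 1 else 0 := by
  induction l generalizing x with
  | nil =>
    obtain rfl := List.length_eq_zero_iff.1 h
    simp
  | cons a l ih =>
    cases x with
    | nil => simp at h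
    | cons c x =>
      have h0 : l.sublists'.count (c :: x) = 0 := by
        refine List.count_eq_zero_of_not_mem fun hm => ?_
        have := (List.mem_sublists'.1 hm).length_le
        simp at h this
        omega
      rw [List.sublists'_cons, List.count_append, h0, count_map_cons, ih (by simpa using h)]
      by_cases hc : c = a <;> simp [hc]

lemma count_sublists'_of_length_succ {x l : List α} (h : x.length + 1 = l.length) :
    l.sublists'.count x = (singleDeletions l).count x := by
  induction l generalizing x with
  | nil => simp at h
  | cons a l ih =>
    have h' : x.length = l.length := by simpa using h
    rw [List.sublists'_cons, List.count_append, count_sublists'_of_length_eq h', singleDeletions,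
      List.count_cons, add_comm]
    congr 1
    · cases x with
      | nil =>
        obtain rfl := List.length_eq_zero_iff.1 h'.symm
        simp [singleDeletions]
      | cons c x => rw [count_map_cons, count_map_cons, ih (by simpa using h')]
    · simp only [beq_iff_eq, eq_comm (a := x)]

lemma exists_runLengths_cons (a : α) (l : List α) :
    ∃ r rs, runLengths (a :: l) = (r + 1) :: rs := by
  cases l with
  | nil => exact ⟨0, [], by simp [runLengths]⟩
  | cons b l =>
    rw [runLengths]
    split_ifs
    · cases runLengths (b :: l) with
      | nil => exact ⟨0, [], rfl⟩
      | cons r rs => exact ⟨r, rs, rfl⟩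
    · exact ⟨0, _, rfl⟩

lemma runLengths_cons_self {a : α} {l : List α} {r : ℕ} {rs : List ℕ}
    (h : runLengths (a :: l) = r :: rs) : runLengths (a :: a :: l) = (r + 1) :: rs := by
  rw [runLengths, if_pos rfl, h]

lemma runLengths_cons_of_head?_ne {a : α} {l : List α} (h : l.head? ≠ some a) :
    runLengths (a :: l) = 1 :: runLengths l := by
  cases l with
  | nil => simp [runLengths]
  | cons b l =>
    rw [runLengths, if_neg]
    rintro rfl
    simp at h

lemma sum_runLengths (l : List α) : (runLengths l).sum = l.length := by
  induction l with
  | nil => simp [runLengths]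
  | cons a l ih =>
    by_cases h : l.head? = some a
    · obtain ⟨l, rfl⟩ := List.head?_eq_some_iff.1 h
      obtain ⟨r, rs, hr⟩ := exists_runLengths_cons a l
      rw [runLengths_cons_self hr]
      rw [hr] at ih
      simp only [List.sum_cons, List.length_cons] at ih ⊢
      omega
    · rw [runLengths_cons_of_head?_ne h]
      simp [ih, add_comm]

lemma runLengths_replicate_append (r : ℕ) {a : α} {l : List α} (h : l.head? ≠ some a) :
    runLengths (List.replicate (r + 1) a ++ l) = (r + 1) :: runLengths l := by
  induction r with
  | zero => simpa using runLengths_cons_of_head?_ne h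
  | succ r ih => exact runLengths_cons_self ih

lemma exists_runLengths_eq [Nontrivial α] {rl : List ℕ} (h : ∀ r ∈ rl, 0 < r) (c : α) :
    ∃ w : List α, runLengths w = rl ∧ w.head? ≠ some c := by
  induction rl generalizing c with
  | nil => exact ⟨[], by simp [runLengths]⟩
  | cons r rs ih =>
    obtain ⟨d, hd⟩ := exists_ne c
    obtain ⟨w, hw, hwd⟩ := ih (fun s hs => h s (List.mem_cons_of_mem _ hs)) d
    obtain ⟨k, rfl⟩ := Nat.exists_eq_succ_of_ne_zero (h r List.mem_cons_self).ne'
    refine ⟨List.replicate (k + 1) d ++ w, ?_, ?_⟩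
    · rw [runLengths_replicate_append k hwd, hw]
    · simpa [List.replicate_succ] using hd

lemma sum_count_singleDeletions (f : ℕ → ℝ) (l : List α) :
    ∑ z ∈ (singleDeletions l).toFinset, f ((singleDeletions l).count z)
        = ((runLengths l).map f).sum
      ∧ ∀ a t, l = a :: t → (runLengths l).head? = some ((singleDeletions l).count t) := by
  induction l with
  | nil => simp [singleDeletions, runLengths]
  | cons a l ih =>
    obtain ⟨ih_sum, ih_head⟩ := ih
    set S := singleDeletions l with hS
    have himage : (S.map (List.cons a)).toFinset = S.toFinset.image (List.cons a) := by
      ext; simp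
    by_cases h : l.head? = some a
    · obtain ⟨t, rfl⟩ := List.head?_eq_some_iff.1 h
      obtain ⟨r, rs, hr⟩ := exists_runLengths_cons a t
      have hcount : S.count t = r + 1 := by
        have := ih_head a t rfl
        rw [hr] at this
        simpa using this.symm
      have ht : t ∈ S.toFinset := List.mem_toFinset.2 List.mem_cons_self
      have hdel : singleDeletions (a :: a :: t) = (a :: t) :: S.map (List.cons a) := rfl
      have hc : ∀ z, (singleDeletions (a :: a :: t)).count (a :: z)
          = S.count z + if t = z then 1 else 0 := by
        intro z
        rw [hdel, List.count_cons, count_map_cons, if_pos rfl]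
        simp
      have hfin : (singleDeletions (a :: a :: t)).toFinset = S.toFinset.image (List.cons a) := by
        rw [hdel, List.toFinset_cons, himage, Finset.insert_eq_of_mem]
        exact Finset.mem_image_of_mem _ ht
      refine ⟨?_, ?_⟩
      · rw [hfin, Finset.sum_image (fun _ _ _ _ h => List.cons_injective h),
          runLengths_cons_self hr]
        rw [hr, ← Finset.add_sum_erase _ _ ht, hcount, List.map_cons, List.sum_cons] at ih_sum
        rw [← Finset.add_sum_erase _ _ ht, hc, hcount, if_pos rfl, List.map_cons, List.sum_cons,
          ← add_left_cancel ih_sum]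
        congr 1
        refine Finset.sum_congr rfl fun z hz => ?_
        rw [hc, if_neg (Finset.ne_of_mem_erase hz).symm, add_zero]
      · rintro b u hu
        obtain ⟨rfl, rfl⟩ := List.cons.inj hu
        rw [hc, hcount, runLengths_cons_self hr, if_pos rfl, List.head?_cons]
    · have hdel : singleDeletions (a :: l) = l :: S.map (List.cons a) := rfl
      have hl : l ∉ S.map (List.cons a) := by
        intro hm
        obtain ⟨w, _, rfl⟩ := List.mem_map.1 hm
        simp at h
      refine ⟨?_, ?_⟩
      · rw [hdel, List.toFinset_cons, Finset.sum_insert (by simpa using hl), himage,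
          Finset.sum_image (fun _ _ _ _ h => List.cons_injective h),
          runLengths_cons_of_head?_ne h, List.map_cons, List.sum_cons, ← ih_sum,
          List.count_cons_self, List.count_eq_zero_of_not_mem hl]
        congr 1
        refine Finset.sum_congr rfl fun z _ => ?_
        have : l ≠ a :: z := by
          rintro rfl
          simp at h
        rw [List.count_cons_of_ne this, count_map_cons, if_pos rfl]
      · rintro b u hu
        obtain ⟨rfl, rfl⟩ := List.cons.inj hu
        rw [hdel, runLengths_cons_of_head?_ne h, List.count_cons_self,
          List.count_eq_zero_of_not_mem hl, List.head?_cons]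

end Runs

lemma sum_emb_eq_sum_runLengths (q n : ℕ) (y : Fin (n + 1) → Fin q) (f : ℕ → ℝ) :
    ∑ x ∈ Finset.univ.filter
      (fun x : Fin n → Fin q => (List.ofFn x).Sublist (List.ofFn y)),
      f (emb (List.ofFn x) (List.ofFn y)) = ((runLengths (List.ofFn y)).map f).sum := by
  have hemb : ∀ x : Fin n → Fin q,
      emb (List.ofFn x) (List.ofFn y) = (singleDeletions (List.ofFn y)).count (List.ofFn x) := by
    intro x
    rw [emb, (List.sublists_perm_sublists' _).count_eq,
      count_sublists'_of_length_succ (by simp)]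
  have hmem : ∀ x : Fin n → Fin q, (List.ofFn x).Sublist (List.ofFn y) ↔
      List.ofFn x ∈ singleDeletions (List.ofFn y) := by
    intro x
    rw [← List.count_pos_iff, ← hemb, emb, List.count_pos_iff, List.mem_sublists]
  rw [← (sum_count_singleDeletions f (List.ofFn y)).1]
  refine Finset.sum_nbij List.ofFn ?_ ?_ ?_ ?_
  · intro x hx
    exact List.mem_toFinset.2 ((hmem x).1 (Finset.mem_filter.1 hx).2)
  · exact fun _ _ _ _ h => List.ofFn_injective h
  · intro z hz
    have hz' : z ∈ singleDeletions (List.ofFn y) := by simpa using hz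
    have hlen : z.length = n := by simpa using length_of_mem_singleDeletions hz'
    subst hlen
    refine ⟨z.get, ?_, List.ofFn_get z⟩
    rw [Finset.mem_coe, Finset.mem_filter, hmem, List.ofFn_get]
    exact ⟨Finset.mem_univ _, hz'⟩
  · intro x _
    rw [hemb]

lemma sum_map_affine (a b : ℝ) (L : List ℕ) :
    (L.map fun r : ℕ => a + b * (r : ℝ)).sum = a * L.length + b * (L.sum : ℕ) := by
  induction L with
  | nil => simp
  | cons r L ih =>
    simp only [List.map_cons, List.sum_cons, ih, List.length_cons]
    push_cast
    ring

/-- The input entropy of the single-insertion channel in terms of the run lengths. -/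
lemma Hins_one_eq (q n : ℕ) (y : Fin (n + 1) → Fin q) :
    Hins q n 1 y = Real.logb 2 ((n : ℝ) + 1) - (1 / ((n : ℝ) + 1)) *
      ((runLengths (List.ofFn y)).map fun r : ℕ => (r : ℝ) * Real.logb 2 r).sum := by
  have hm : ((n : ℝ) + 1) ≠ 0 := by positivity
  have h := sum_emb_eq_sum_runLengths q n y
    (fun r => ((r : ℝ) / ((n + 1).choose 1 : ℝ)) * Real.logb 2 ((r : ℝ) / ((n + 1).choose 1 : ℝ)))
  rw [Hins, h]
  have hsum : ((runLengths (List.ofFn y)).sum : ℝ) = (n : ℝ) + 1 := by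
    rw [sum_runLengths]; simp
  have key : ∀ L : List ℕ, (L.map fun r : ℕ => ((r : ℝ) / ((n + 1).choose 1 : ℝ)) *
      Real.logb 2 ((r : ℝ) / ((n + 1).choose 1 : ℝ))).sum
      = (1 / ((n : ℝ) + 1)) * (L.map fun r : ℕ => (r : ℝ) * Real.logb 2 r).sum
        - (L.sum : ℕ) / ((n : ℝ) + 1) * Real.logb 2 ((n : ℝ) + 1) := by
    intro L
    induction L with
    | nil => simp
    | cons r L ih =>
      simp only [List.map_cons, List.sum_cons, ih]
      rw [Nat.choose_one_right]
      rcases Nat.eq_zero_or_pos r with rfl | hr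
      · simp
      · have hr' : (r : ℝ) ≠ 0 := by positivity
        push_cast
        rw [Real.logb_div hr' hm]
        ring
  rw [key, hsum, div_self hm]
  ring

lemma strictConvexOn_mul_logb_two :
    StrictConvexOn ℝ (Set.Ici 0) fun x : ℝ => x * Real.logb 2 x := by
  have h : (fun x : ℝ => x * Real.logb 2 x) = fun x => (Real.log 2)⁻¹ * (x * Real.log x) := by
    funext x
    rw [Real.logb]
    ring
  rw [h]
  have hpos : 0 < (Real.log 2)⁻¹ := inv_pos.2 (Real.log_pos one_lt_two)
  refine ⟨convex_Ici 0, fun x hx y hy hxy a b ha hb hab => ?_⟩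
  have := Real.strictConvexOn_mul_log.2 hx hy hxy ha hb hab
  simp only [smul_eq_mul] at this ⊢
  nlinarith [mul_lt_mul_of_pos_left this hpos]

section Balanced

variable {g : ℝ → ℝ}

/-- A strictly convex function lies above its chord over `[d, d + 1]` at the other integers. -/
lemma StrictConvexOn.chord_lt_natCast (hg : StrictConvexOn ℝ (Set.Ici 0) g) {d t : ℕ}
    (h₁ : t ≠ d) (h₂ : t ≠ d + 1) :
    g d + (g (d + 1) - g d) * ((t : ℝ) - d) < g t := by
  have hd : (0 : ℝ) ≤ d := d.cast_nonneg
  rcases lt_or_gt_of_ne h₁ with h | h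
  · have htd : (t : ℝ) < d := by exact_mod_cast h
    have := hg.slope_strict_mono_adjacent (x := (t : ℝ)) (y := d) (z := d + 1)
      (Set.mem_Ici.2 t.cast_nonneg) (Set.mem_Ici.2 (by linarith)) htd (by linarith)
    rw [add_sub_cancel_left, div_one, div_lt_iff₀ (by linarith)] at this
    linarith
  · have htd : (d : ℝ) + 1 < t := by exact_mod_cast (show d + 1 < t by omega)
    have := hg.slope_strict_mono_adjacent (x := (d : ℝ)) (y := d + 1) (z := t)
      (Set.mem_Ici.2 hd) (Set.mem_Ici.2 (by linarith)) (by linarith) htd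
    rw [add_sub_cancel_left, div_one, lt_div_iff₀ (by linarith)] at this
    linarith

lemma StrictConvexOn.chord_le_natCast (hg : StrictConvexOn ℝ (Set.Ici 0) g) (d t : ℕ) :
    g d + (g (d + 1) - g d) * ((t : ℝ) - d) ≤ g t := by
  by_cases h₁ : t = d
  · simp [h₁]
  by_cases h₂ : t = d + 1
  · simp [h₂]
  exact (hg.chord_lt_natCast h₁ h₂).le

lemma ceil_div_of_mod_ne_zero {m R : ℕ} (hR : 0 < R) (h : m % R ≠ 0) :
    (m + R - 1) / R = m / R + 1 := by
  rw [Nat.div_eq_iff hR]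
  have := Nat.div_add_mod m R
  have := Nat.mod_lt m hR
  rw [Nat.add_mul, Nat.mul_comm (m / R)]
  omega

lemma isBalanced_iff {m R : ℕ} (hR : 0 < R) {L : List ℕ} :
    isBalanced m R L ↔
      L.Perm (List.replicate (m % R) (m / R + 1) ++ List.replicate (R - m % R) (m / R)) := by
  rw [isBalanced]
  by_cases h : m % R = 0
  · simp [h]
  · rw [ceil_div_of_mod_ne_zero hR h]

lemma sum_chord {m R : ℕ} (hR : 0 < R) {L : List ℕ} (hlen : L.length = R) (hsum : L.sum = m)
    (A B : ℝ) :
    (L.map fun r : ℕ => A + (B - A) * ((r : ℝ) - ((m / R : ℕ) : ℝ))).sum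
      = ((m % R : ℕ) : ℝ) * B + ((R - m % R : ℕ) : ℝ) * A := by
  have h := sum_map_affine (A - (B - A) * ((m / R : ℕ) : ℝ)) (B - A) L
  have hm : (m : ℝ) = R * ((m / R : ℕ) : ℝ) + ((m % R : ℕ) : ℝ) := by
    exact_mod_cast (Nat.div_add_mod m R).symm
  rw [hlen, hsum] at h
  rw [Nat.cast_sub (Nat.mod_lt m hR).le]
  calc _ = _ := by
        congr 2
        funext r
        ring
    _ = _ := h
    _ = _ := by linear_combination (B - A) * hm

lemma exists_perm_replicate_append {d : ℕ} {L : List ℕ} (h : ∀ r ∈ L, r = d ∨ r = d + 1) :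
    ∃ a b, L.Perm (List.replicate a (d + 1) ++ List.replicate b d) := by
  induction L with
  | nil => exact ⟨0, 0, by simp⟩
  | cons r L ih =>
    obtain ⟨a, b, hab⟩ := ih fun s hs => h s (List.mem_cons_of_mem _ hs)
    rcases h r List.mem_cons_self with rfl | rfl
    · exact ⟨a, b + 1, (hab.cons _).trans List.perm_middle.symm⟩
    · exact ⟨a + 1, b, hab.cons _⟩

lemma isBalanced_of_forall_mem {m R : ℕ} (hR : 0 < R) {L : List ℕ} (hlen : L.length = R)
    (hsum : L.sum = m) (h : ∀ r ∈ L, r = m / R ∨ r = m / R + 1) : isBalanced m R L := by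
  obtain ⟨a, b, hab⟩ := exists_perm_replicate_append h
  have h₁ : a + b = R := by
    rw [← hlen, hab.length_eq]
    simp
  have h₂ : m = R * (m / R) + a := by
    conv_lhs => rw [← hsum, hab.sum_eq]
    rw [← h₁]
    simp only [List.sum_append, List.sum_replicate, smul_eq_mul]
    ring
  have h₃ := Nat.div_add_mod m R
  have ha : m % R = a := by omega
  rw [isBalanced_iff hR, ha, ← h₁, Nat.add_sub_cancel_left, h₁]
  exact hab

/-- For a strictly convex `g`, the sum of `g` over the parts of a composition of `m` into `R`
parts is smallest exactly for the balanced compositions. -/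
lemma StrictConvexOn.balanced_sum_le (hg : StrictConvexOn ℝ (Set.Ici 0) g) {m R : ℕ} (hR : 0 < R)
    {L : List ℕ} (hlen : L.length = R) (hsum : L.sum = m) :
    ((m % R : ℕ) : ℝ) * g ((m / R : ℕ) + 1) + ((R - m % R : ℕ) : ℝ) * g (m / R : ℕ)
        ≤ (L.map fun r : ℕ => g r).sum
      ∧ ((L.map fun r : ℕ => g r).sum
          = ((m % R : ℕ) : ℝ) * g ((m / R : ℕ) + 1) + ((R - m % R : ℕ) : ℝ) * g (m / R : ℕ)
        ↔ isBalanced m R L) := by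
  rw [← sum_chord hR hlen hsum]
  refine ⟨List.sum_le_sum fun r _ => hg.chord_le_natCast _ r, fun h => ?_, fun h => ?_⟩
  · refine isBalanced_of_forall_mem hR hlen hsum fun r hr => ?_
    by_contra! hne
    exact (List.sum_lt_sum _ _ (fun s _ => hg.chord_le_natCast (m / R) s)
      ⟨r, hr, hg.chord_lt_natCast hne.1 hne.2⟩).ne' h
  · rw [sum_chord hR hlen hsum, (((isBalanced_iff hR).1 h).map _).sum_eq]
    simp

end Balanced

lemma forall_mem_isBalanced_pos {m R : ℕ} (hR : 0 < R) (hRm : R ≤ m) {L : List ℕ}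
    (h : isBalanced m R L) : ∀ r ∈ L, 0 < r := by
  intro r hr
  have hd : 0 < m / R := Nat.div_pos hRm hR
  rcases List.mem_append.1 (((isBalanced_iff hR).1 h).mem_iff.1 hr) with h | h
  · rw [List.eq_of_mem_replicate h]
    omega
  · rw [List.eq_of_mem_replicate h]
    exact hd

lemma exists_isBalanced_word {q m R : ℕ} (hq : 2 ≤ q) (hR : 0 < R) (hRm : R ≤ m) :
    ∃ y : Fin m → Fin q, (runLengths (List.ofFn y)).length = R ∧
      isBalanced m R (runLengths (List.ofFn y)) := by
  have : Nontrivial (Fin q) := Fin.nontrivial_iff_two_le.2 hq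
  have hmod := Nat.mod_lt m hR
  have hdiv := Nat.div_add_mod m R
  set L := List.replicate (m % R) (m / R + 1) ++ List.replicate (R - m % R) (m / R) with hL
  have hbal : isBalanced m R L := (isBalanced_iff hR).2 (List.Perm.refl _)
  obtain ⟨w, hw, -⟩ := exists_runLengths_eq (forall_mem_isBalanced_pos hR hRm hbal)
    (⟨0, by omega⟩ : Fin q)
  have hlen : w.length = m := by
    rw [← sum_runLengths, hw, hL]
    simp only [List.sum_append, List.sum_replicate, smul_eq_mul]
    obtain ⟨k, hk⟩ := Nat.exists_eq_add_of_le hmod.le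
    rw [show R - m % R = k by omega, Nat.mul_add, mul_one]
    calc _ = (m % R + k) * (m / R) + m % R := by ring
      _ = m := by rw [← hk, hdiv]
  clear_value L
  subst hlen
  refine ⟨w.get, ?_, ?_⟩
  · rw [List.ofFn_get, hw, ((isBalanced_iff hR).1 hbal).length_eq]
    simp only [List.length_append, List.length_replicate]
    omega
  · rwa [List.ofFn_get, hw]

/-- For `n ≥ 1`, `q ≥ 2`, `m = n+1`, `R ∈ [m]` and `r = m mod R`, the maximum of
`H^In_{1-Ins}` over all channel outputs in `Σ_{q,R}^m` equals
`log₂ m - (1/m)(r ⌈m/R⌉ log₂⌈m/R⌉ + (R-r) ⌊m/R⌋ log₂⌊m/R⌋)`,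
and it is attained exactly by the balanced channel outputs. -/
theorem stmt_10 (q n R : ℕ) (hq : 2 ≤ q) (hn : 1 ≤ n) (hR1 : 1 ≤ R) (hRm : R ≤ n + 1) :
    IsGreatest
      ((fun y : Fin (n + 1) → Fin q => Hins q n 1 y) ''
        {y | (runLengths (List.ofFn y)).length = R})
      (Real.logb 2 ((n : ℝ) + 1)
        - (1 / ((n : ℝ) + 1)) *
            ((((n + 1) % R : ℕ) : ℝ) * (((n + 1 + R - 1) / R : ℕ) : ℝ) *
                Real.logb 2 (((n + 1 + R - 1) / R : ℕ) : ℝ)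
              + ((R - (n + 1) % R : ℕ) : ℝ) * (((n + 1) / R : ℕ) : ℝ) *
                  Real.logb 2 (((n + 1) / R : ℕ) : ℝ)))
    ∧ ∀ y : Fin (n + 1) → Fin q, (runLengths (List.ofFn y)).length = R →
        (Hins q n 1 y =
            Real.logb 2 ((n : ℝ) + 1)
              - (1 / ((n : ℝ) + 1)) *
                  ((((n + 1) % R : ℕ) : ℝ) * (((n + 1 + R - 1) / R : ℕ) : ℝ) *
                      Real.logb 2 (((n + 1 + R - 1) / R : ℕ) : ℝ)
                    + ((R - (n + 1) % R : ℕ) : ℝ) * (((n + 1) / R : ℕ) : ℝ) *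
                        Real.logb 2 (((n + 1) / R : ℕ) : ℝ))
          ↔ isBalanced (n + 1) R (runLengths (List.ofFn y))) := by
  have hg := strictConvexOn_mul_logb_two
  have hmpos : (0 : ℝ) < 1 / ((n : ℝ) + 1) := by positivity
  have hval : (((n + 1) % R : ℕ) : ℝ) * (((n + 1 + R - 1) / R : ℕ) : ℝ) *
          Real.logb 2 (((n + 1 + R - 1) / R : ℕ) : ℝ)
        + ((R - (n + 1) % R : ℕ) : ℝ) * (((n + 1) / R : ℕ) : ℝ) *
            Real.logb 2 (((n + 1) / R : ℕ) : ℝ)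
      = (((n + 1) % R : ℕ) : ℝ) * (((((n + 1) / R : ℕ) : ℝ) + 1) *
          Real.logb 2 ((((n + 1) / R : ℕ) : ℝ) + 1))
        + ((R - (n + 1) % R : ℕ) : ℝ) * ((((n + 1) / R : ℕ) : ℝ) *
            Real.logb 2 (((n + 1) / R : ℕ) : ℝ)) := by
    by_cases h : (n + 1) % R = 0
    · rw [h, Nat.cast_zero]
      ring
    · rw [ceil_div_of_mod_ne_zero hR1 h, Nat.cast_add, Nat.cast_one]
      ring
  have hmin : ∀ y : Fin (n + 1) → Fin q, (runLengths (List.ofFn y)).length = R → _ :=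
    fun y hy => hg.balanced_sum_le (m := n + 1) hR1 hy (by rw [sum_runLengths, List.length_ofFn])
  rw [hval]
  suffices hiff : ∀ y : Fin (n + 1) → Fin q, (runLengths (List.ofFn y)).length = R →
      (_ ↔ isBalanced (n + 1) R (runLengths (List.ofFn y))) by
    refine ⟨⟨?_, ?_⟩, hiff⟩
    · obtain ⟨y, hy, hbal⟩ := exists_isBalanced_word hq hR1 hRm
      exact ⟨y, hy, (hiff y hy).2 hbal⟩
    · rintro _ ⟨y, hy, rfl⟩
      simp only [Hins_one_eq]
      exact sub_le_sub_left (mul_le_mul_of_nonneg_left (hmin y hy).1 hmpos.le) _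
  intro y hy
  rw [Hins_one_eq, ← (hmin y hy).2, sub_right_inj, mul_right_inj' hmpos.ne']

end
end
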